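/- Let H be a d×d complex matrix and H_k a (k+1)×(k+1) complex tridiagonal matrix (i.e., (H_k)_{ij} = 0 whenever |i−j| > 1). Let V be a d×(k+1) complex matrix, set |r⟩ = V|e_0⟩, and assume H V = V H_k + |v⟩⟨e_k| for some vector |v⟩ ∈ ℂ^d (where |e_j⟩ denotes the j-th standard basis vector of ℂ^{k+1}, indexed from 0). Then for every natural number n with n ≤ k, one has H^n |r⟩ = V H_k^n |e_0⟩. -/

import Mathlib

open Matrix

/-- If `A` has no entries below its first subdiagonal, then `Aⁿ e₀` is supported on the
first `n + 1` coordinates. -/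
theorem Matrix.pow_mulVec_single_zero_apply_eq_zero {R : Type*} [CommSemiring R] {k : ℕ}
    {A : Matrix (Fin (k + 1)) (Fin (k + 1)) R}
    (hA : ∀ i j : Fin (k + 1), (j : ℕ) + 1 < i → A i j = 0)
    (n : ℕ) {i : Fin (k + 1)} (hi : n < (i : ℕ)) :
    ((A ^ n) *ᵥ Pi.single 0 1) i = 0 := by
  induction n generalizing i with
  | zero =>
    have hi0 : i ≠ 0 := by
      rintro rfl
      simp at hi
    simp [hi0]
  | succ n ih =>
    rw [pow_succ', ← mulVec_mulVec]
    simp only [mulVec, dotProduct] at ih ⊢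
    refine Finset.sum_eq_zero fun j _ => ?_
    rcases lt_or_ge n (j : ℕ) with hj | hj
    · rw [ih hj, mul_zero]
    · rw [hA i j (by omega), zero_mul]

/-- Key inductive lemma: powers of `H` applied to `r = V e₀` are exactly represented
in the Krylov basis, i.e. `Hⁿ r = V H_kⁿ e₀` for all `n ≤ k`. -/
theorem lanczos_powers_exact {d k : ℕ}
    (H : Matrix (Fin d) (Fin d) ℂ)
    (Hk : Matrix (Fin (k + 1)) (Fin (k + 1)) ℂ)
    (hTri : ∀ i j : Fin (k + 1), 1 < |(i : ℤ) - (j : ℤ)| → Hk i j = 0)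
    (V : Matrix (Fin d) (Fin (k + 1)) ℂ)
    (v : Fin d → ℂ)
    (hRec : H * V = V * Hk + Matrix.vecMulVec v (Pi.single (Fin.last k) 1))
    (r : Fin d → ℂ) (hr : r = V *ᵥ Pi.single 0 1)
    (n : ℕ) (hn : n ≤ k) :
    (H ^ n) *ᵥ r = V *ᵥ ((Hk ^ n) *ᵥ Pi.single 0 1) := by
  have hHess : ∀ i j : Fin (k + 1), (j : ℕ) + 1 < i → Hk i j = 0 := fun i j hij =>
    hTri i j (lt_abs.mpr (Or.inl (by omega)))
  induction n with
  | zero => rw [pow_zero, pow_zero, one_mulVec, one_mulVec, hr]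
  | succ n ih =>
    have hlast : ((Hk ^ n) *ᵥ Pi.single 0 1) (Fin.last k) = 0 :=
      pow_mulVec_single_zero_apply_eq_zero hHess n (by simpa using hn)
    rw [pow_succ', ← mulVec_mulVec, ih (by omega), mulVec_mulVec, hRec, add_mulVec,
      vecMulVec_mulVec, single_one_dotProduct, hlast, MulOpposite.op_zero, zero_smul, add_zero,
      pow_succ', ← mulVec_mulVec, ← mulVec_mulVec]
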